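/- arXiv:1901.09018 — 8 statements merged into one kernel-verified Lean document; each statement's English description precedes it below -/
import Mathlib

section
/- Let S, A, S' be finite nonempty sets, let p be a transition kernel from S×A to S', and let U denote the uniform distribution on S×A. Fix two states s₁', s₂' ∈ S' with Z_U(s₁') > 0 and Z_U(s₂') > 0, and suppose the backward probability vectors satisfy b_U(s₁') = b_U(s₂'). Then for every probability distribution ν on S×A such that Z_ν(s₁') > 0 and Z_ν(s₂') > 0, one has b_ν(s₁') = b_ν(s₂'). -/
/-- If the backward probability vectors of two next-states agree
under the uniform distribution, they agree under any distribution ν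
(with positive normalizers). -/
theorem backward_prob_eq_of_uniform_eq
    {S A S' : Type*} [Fintype S] [Fintype A] [Fintype S']
    [Nonempty S] [Nonempty A] [Nonempty S']
    (p : S × A → S' → ℝ)
    (hp_nonneg : ∀ sa s', 0 ≤ p sa s')
    (hp_sum : ∀ sa, ∑ s', p sa s' = 1)
    (U : S × A → ℝ)
    (hU : ∀ sa, U sa = 1 / ((Fintype.card S : ℝ) * (Fintype.card A : ℝ)))
    (s₁' s₂' : S')
    (hZU1 : 0 < ∑ sa, p sa s₁' * U sa)
    (hZU2 : 0 < ∑ sa, p sa s₂' * U sa)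
    (hbU : (fun sa => p sa s₁' * U sa / ∑ sa', p sa' s₁' * U sa')
         = (fun sa => p sa s₂' * U sa / ∑ sa', p sa' s₂' * U sa'))
    (ν : S × A → ℝ)
    (hν_nonneg : ∀ sa, 0 ≤ ν sa)
    (hν_sum : ∑ sa, ν sa = 1)
    (hZν1 : 0 < ∑ sa, p sa s₁' * ν sa)
    (hZν2 : 0 < ∑ sa, p sa s₂' * ν sa) :
    (fun sa => p sa s₁' * ν sa / ∑ sa', p sa' s₁' * ν sa')
      = (fun sa => p sa s₂' * ν sa / ∑ sa', p sa' s₂' * ν sa') := by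
  obtain ⟨c, hc, h⟩ : ∃ c : ℝ, c ≠ 0 ∧ ∀ sa, p sa s₁' = c * p sa s₂' := by
    refine ⟨(∑ sa, p sa s₁' * U sa) / ∑ sa, p sa s₂' * U sa,
      (div_pos hZU1 hZU2).ne', fun sa => ?_⟩
    have hUpos : 0 < U sa := by
      rw [hU]
      have := Fintype.card_pos (α := S)
      have := Fintype.card_pos (α := A)
      positivity
    have hb := congrFun hbU sa
    rw [div_eq_div_iff hZU1.ne' hZU2.ne'] at hb
    rw [div_mul_eq_mul_div, eq_div_iff hZU2.ne']
    exact mul_right_cancel₀ hUpos.ne' (by linear_combination hb)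
  funext sa
  simp only [h, mul_assoc, ← Finset.mul_sum]
  exact mul_div_mul_left _ _ hc
end

section
/- Let S, A, S' be finite nonempty sets, let p be a transition kernel from S×A to S', and let U denote the uniform distribution on S×A. Fix two states s₁', s₂' ∈ S' with Z_U(s₁') > 0 and Z_U(s₂') > 0, and suppose the backward probability vectors satisfy b_U(s₁') ≠ b_U(s₂'). Then for every probability distribution ν on S×A with ν(s,a) > 0 for all (s,a) ∈ S×A, one has b_ν(s₁') ≠ b_ν(s₂'). -/
/-- A nonnegative function with nonzero total weight for some weight function has positive total
weight for every strictly positive weight function. -/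
theorem sum_mul_pos_of_sum_mul_ne_zero {ι : Type*} [Fintype ι] {f u v : ι → ℝ}
    (hf : ∀ i, 0 ≤ f i) (hu : ∑ i, f i * u i ≠ 0) (hv : ∀ i, 0 < v i) :
    0 < ∑ i, f i * v i := by
  obtain ⟨i, -, hi⟩ := Finset.exists_ne_zero_of_sum_ne_zero hu
  exact Finset.sum_pos' (fun j _ => mul_nonneg (hf j) (hv j).le)
    ⟨i, Finset.mem_univ i, mul_pos ((hf i).lt_of_ne' (left_ne_zero_of_mul hi)) (hv i)⟩

/-- Proportional functions have the same normalization with respect to any weight. -/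
theorem mul_div_sum_eq_of_eq_const_mul {ι : Type*} [Fintype ι] {f g : ι → ℝ} {c : ℝ}
    (hc : c ≠ 0) (h : ∀ i, f i = c * g i) (u : ι → ℝ) (i : ι) :
    f i * u i / ∑ j, f j * u j = g i * u i / ∑ j, g j * u j := by
  simp only [h, mul_assoc, ← Finset.mul_sum]
  exact mul_div_mul_left _ _ hc

/-- If the backward probability vectors of two next-states differ
under the uniform distribution, they differ under any fully supported
distribution ν. -/
theorem backward_prob_ne_of_uniform_ne
    {S A S' : Type*} [Fintype S] [Fintype A] [Fintype S']
    [Nonempty S] [Nonempty A] [Nonempty S']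
    (p : S × A → S' → ℝ)
    (hp_nonneg : ∀ sa s', 0 ≤ p sa s')
    (hp_sum : ∀ sa, ∑ s', p sa s' = 1)
    (U : S × A → ℝ)
    (hU : ∀ sa, U sa = 1 / ((Fintype.card S : ℝ) * (Fintype.card A : ℝ)))
    (s₁' s₂' : S')
    (hZU1 : 0 < ∑ sa, p sa s₁' * U sa)
    (hZU2 : 0 < ∑ sa, p sa s₂' * U sa)
    (hbU : (fun sa => p sa s₁' * U sa / ∑ sa', p sa' s₁' * U sa')
         ≠ (fun sa => p sa s₂' * U sa / ∑ sa', p sa' s₂' * U sa'))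
    (ν : S × A → ℝ)
    (hν_pos : ∀ sa, 0 < ν sa)
    (hν_sum : ∑ sa, ν sa = 1) :
    (fun sa => p sa s₁' * ν sa / ∑ sa', p sa' s₁' * ν sa')
      ≠ (fun sa => p sa s₂' * ν sa / ∑ sa', p sa' s₂' * ν sa') := by
  intro h
  have hZ₁ := sum_mul_pos_of_sum_mul_ne_zero (fun sa => hp_nonneg sa s₁') hZU1.ne' hν_pos
  have hZ₂ := sum_mul_pos_of_sum_mul_ne_zero (fun sa => hp_nonneg sa s₂') hZU2.ne' hν_pos
  refine hbU (funext (mul_div_sum_eq_of_eq_const_mul (div_pos hZ₁ hZ₂).ne' (fun sa => ?_) U))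
  have hsa := congrFun h sa
  rw [div_eq_div_iff hZ₁.ne' hZ₂.ne'] at hsa
  rw [div_mul_eq_mul_div, eq_div_iff hZ₂.ne']
  apply mul_right_cancel₀ (hν_pos sa).ne'
  linear_combination hsa
end

section
/- Let S, A, S' be finite nonempty sets, let p be a transition kernel from S×A to S', and let U denote the uniform distribution on S×A. Let τ > 0 and γ > 0, and let ν be a probability distribution on S×A with ν(s,a) ≥ τ for every (s,a) ∈ S×A. If s₁', s₂' ∈ S' satisfy Z_U(s₁') > 0, Z_U(s₂') > 0 and ‖b_U(s₁') − b_U(s₂')‖₁ ≥ γ, then ‖b_ν(s₁') − b_ν(s₂')‖₁ ≥ τγ/2. -/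
/-- Reweighting two probability vectors by weights in `[τ, 1]` and renormalizing shrinks
their ℓ₁ distance by a factor of at most `τ / 2`. -/
theorem sum_abs_sub_le_sum_abs_reweight_sub {ι : Type*} [Fintype ι] {u v ν : ι → ℝ} {τ : ℝ}
    (hτ : 0 < τ) (hu : ∀ i, 0 ≤ u i) (hv : ∀ i, 0 ≤ v i)
    (hu_sum : ∑ i, u i = 1) (hv_sum : ∑ i, v i = 1)
    (hν_lb : ∀ i, τ ≤ ν i) (hν_ub : ∀ i, ν i ≤ 1) :
    τ * (∑ i, |u i - v i|) / 2 ≤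
      ∑ i, |u i * ν i / (∑ j, u j * ν j) - v i * ν i / (∑ j, v j * ν j)| := by
  have mean_pos : ∀ w : ι → ℝ, (∀ i, 0 ≤ w i) → ∑ i, w i = 1 → 0 < ∑ i, w i * ν i := by
    intro w hw hw_sum
    calc 0 < (∑ i, w i) * τ := by rw [hw_sum, one_mul]; exact hτ
      _ = ∑ i, w i * τ := Finset.sum_mul ..
      _ ≤ _ := Finset.sum_le_sum fun i _ => mul_le_mul_of_nonneg_left (hν_lb i) (hw i)
  have hm := mean_pos u hu hu_sum
  have hn := mean_pos v hv hv_sum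
  have hm_le : ∑ i, u i * ν i ≤ 1 :=
    (Finset.sum_le_sum fun i _ => mul_le_of_le_one_right (hu i) (hν_ub i)).trans hu_sum.le
  set m := ∑ i, u i * ν i
  set n := ∑ i, v i * ν i
  set d : ι → ℝ := fun i => u i / m - v i / n
  have hd_sum : ∑ i, d i = 1 / m - 1 / n := by
    simp only [d, Finset.sum_sub_distrib, ← Finset.sum_div, hu_sum, hv_sum]
  have hsub : ∀ i, u i - v i = m * (d i - (∑ j, d j) * v i) := by
    intro i
    rw [hd_sum]
    simp only [d]
    field_simp
    ring
  have hdist : ∑ i, |u i - v i| ≤ 2 * ∑ i, |d i| :=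
    calc ∑ i, |u i - v i| ≤ ∑ i, (|d i| + (∑ j, |d j|) * v i) := by
          refine Finset.sum_le_sum fun i _ => ?_
          rw [hsub, abs_mul, abs_of_pos hm]
          refine (mul_le_of_le_one_left (abs_nonneg _) hm_le).trans ?_
          refine (abs_sub _ _).trans ?_
          rw [abs_mul, abs_of_nonneg (hv i)]
          gcongr
          · exact hv i
          · exact Finset.abs_sum_le_sum_abs _ _
      _ = 2 * ∑ i, |d i| := by
          rw [Finset.sum_add_distrib, ← Finset.mul_sum, hv_sum]
          ring
  calc τ * (∑ i, |u i - v i|) / 2 ≤ τ * ∑ i, |d i| := by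
        linarith [mul_le_mul_of_nonneg_left hdist hτ.le]
    _ = ∑ i, τ * |d i| := Finset.mul_sum ..
    _ ≤ _ := by
        refine Finset.sum_le_sum fun i _ => ?_
        have : u i * ν i / m - v i * ν i / n = ν i * d i := by simp only [d]; ring
        rw [this, abs_mul, abs_of_pos (hτ.trans_le (hν_lb i))]
        exact mul_le_mul_of_nonneg_right (hν_lb i) (abs_nonneg _)


/-- If backward probability vectors of two next-states are
γ-separated in ℓ₁ under the uniform distribution, then under any distribution ν
with all entries ≥ τ they are (τγ/2)-separated. -/
theorem backward_prob_margin
    {S A S' : Type*} [Fintype S] [Fintype A] [Fintype S']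
    [Nonempty S] [Nonempty A] [Nonempty S']
    (p : S × A → S' → ℝ)
    (hp_nonneg : ∀ sa s', 0 ≤ p sa s')
    (hp_sum : ∀ sa, ∑ s', p sa s' = 1)
    (U : S × A → ℝ)
    (hU : ∀ sa, U sa = 1 / ((Fintype.card S : ℝ) * (Fintype.card A : ℝ)))
    (τ γ : ℝ) (hτ : 0 < τ) (hγ : 0 < γ)
    (ν : S × A → ℝ)
    (hν_lb : ∀ sa, τ ≤ ν sa)
    (hν_sum : ∑ sa, ν sa = 1)
    (s₁' s₂' : S')
    (hZU1 : 0 < ∑ sa, p sa s₁' * U sa)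
    (hZU2 : 0 < ∑ sa, p sa s₂' * U sa)
    (hsep : γ ≤ ∑ sa, |p sa s₁' * U sa / (∑ sa', p sa' s₁' * U sa')
                      - p sa s₂' * U sa / (∑ sa', p sa' s₂' * U sa')|) :
    τ * γ / 2 ≤ ∑ sa, |p sa s₁' * ν sa / (∑ sa', p sa' s₁' * ν sa')
                      - p sa s₂' * ν sa / (∑ sa', p sa' s₂' * ν sa')| := by
  obtain ⟨k, hk, hUk⟩ : ∃ k : ℝ, 0 < k ∧ ∀ sa, U sa = k :=
    ⟨_, by positivity, hU⟩
  simp only [hUk] at hZU1 hZU2 hsep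
  have hν_ub : ∀ sa, ν sa ≤ 1 := fun sa => hν_sum ▸
    Finset.single_le_sum (fun i _ => hτ.le.trans (hν_lb i)) (Finset.mem_univ sa)
  have renormalize : ∀ s', 0 < ∑ sa, p sa s' * k → ∀ sa,
      p sa s' * k / (∑ i, p i s' * k) * ν sa /
        (∑ j, p j s' * k / (∑ i, p i s' * k) * ν j) =
      p sa s' * ν sa / ∑ j, p j s' * ν j := by
    intro s' hZ sa
    have hscale : ∀ j, p j s' * k / (∑ i, p i s' * k) * ν j =
        k / (∑ i, p i s' * k) * (p j s' * ν j) := fun j => by ring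
    simp only [hscale, ← Finset.mul_sum]
    exact mul_div_mul_left _ _ (div_pos hk hZ).ne'
  have key := sum_abs_sub_le_sum_abs_reweight_sub hτ
    (u := fun sa => p sa s₁' * k / ∑ i, p i s₁' * k)
    (v := fun sa => p sa s₂' * k / ∑ i, p i s₂' * k)
    (fun sa => div_nonneg (mul_nonneg (hp_nonneg sa s₁') hk.le) hZU1.le)
    (fun sa => div_nonneg (mul_nonneg (hp_nonneg sa s₂') hk.le) hZU2.le)
    (by rw [← Finset.sum_div, div_self hZU1.ne'])
    (by rw [← Finset.sum_div, div_self hZU2.ne'])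
    hν_lb hν_ub
  simp only [renormalize s₁' hZU1, renormalize s₂' hZU2] at key
  refine le_trans ?_ key
  gcongr
end

section
/- Let d be a positive integer and let p, q ∈ ℝ^d be nonzero vectors with nonnegative entries. Then ‖p/‖p‖₁ − q/‖q‖₁‖₁ ≤ 2‖p − q‖₁ / max(‖p‖₁, ‖q‖₁). -/
/-- Normalizing two vectors of nonzero ℓ₁ norm moves them apart by at most twice their ℓ₁ distance
relative to the norm of the first one. -/
theorem sum_abs_div_sum_abs_sub_le {ι : Type*} [Fintype ι] (p q : ι → ℝ)
    (hp : 0 < ∑ i, |p i|) (hq : 0 < ∑ i, |q i|) :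
    ∑ i, |p i / (∑ j, |p j|) - q i / (∑ j, |q j|)|
      ≤ 2 * (∑ i, |p i - q i|) / ∑ i, |p i| := by
  have hdiff : |(∑ i, |q i|) - (∑ i, |p i|)| ≤ ∑ i, |p i - q i| := by
    rw [← Finset.sum_sub_distrib]
    refine (Finset.abs_sum_le_sum_abs _ _).trans (Finset.sum_le_sum fun i _ => ?_)
    rw [abs_sub_comm (p i)]
    exact abs_abs_sub_abs_le_abs_sub (q i) (p i)
  set A := ∑ i, |p i|
  set B := ∑ i, |q i| with hB
  have hterm (i : ι) : |p i / A - q i / B| ≤ |p i - q i| / A + |q i| * (|B - A| / (A * B)) := by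
    have h : p i / A - q i / B = (p i - q i) / A + q i * ((B - A) / (A * B)) := by
      field_simp
      ring
    rw [h]
    refine (abs_add_le _ _).trans_eq ?_
    rw [abs_div, abs_mul, abs_div, abs_of_pos hp, abs_of_pos (mul_pos hp hq)]
  calc ∑ i, |p i / A - q i / B|
      ≤ ∑ i, (|p i - q i| / A + |q i| * (|B - A| / (A * B))) :=
        Finset.sum_le_sum fun i _ => hterm i
    _ = ((∑ i, |p i - q i|) + |B - A|) / A := by
        rw [Finset.sum_add_distrib, ← Finset.sum_div, ← Finset.sum_mul, ← hB]
        field_simp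
    _ ≤ 2 * (∑ i, |p i - q i|) / A := by
        gcongr
        linarith

/-- The ℓ₁ norm of a nonzero vector is positive. -/
theorem sum_abs_pos_of_ne_zero {ι : Type*} [Fintype ι] {p : ι → ℝ} (hp : p ≠ 0) :
    0 < ∑ i, |p i| := by
  obtain ⟨i, hi⟩ := Function.ne_iff.mp hp
  exact Finset.sum_pos' (fun _ _ => abs_nonneg _) ⟨i, Finset.mem_univ i, abs_pos.mpr hi⟩

/-- ℓ₁ perturbation bound for normalized nonnegative vectors. -/
theorem normalization_perturbation
    {d : ℕ} (hd : 0 < d) (p q : Fin d → ℝ)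
    (hp_nonneg : ∀ i, 0 ≤ p i) (hq_nonneg : ∀ i, 0 ≤ q i)
    (hp_ne : p ≠ 0) (hq_ne : q ≠ 0) :
    ∑ i, |p i / (∑ j, |p j|) - q i / (∑ j, |q j|)|
      ≤ 2 * (∑ i, |p i - q i|) / max (∑ i, |p i|) (∑ i, |q i|) := by
  have hp := sum_abs_pos_of_ne_zero hp_ne
  have hq := sum_abs_pos_of_ne_zero hq_ne
  rcases max_choice (∑ i, |p i|) (∑ i, |q i|) with h | h <;> rw [h]
  · exact sum_abs_div_sum_abs_sub_le p q hp hq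
  · simpa only [abs_sub_comm] using sum_abs_div_sum_abs_sub_le q p hq hp
end

section
/- Let d be a positive integer and let p₁, p₂ ∈ ℝ^d be vectors with strictly positive entries. Let p₁ ⊘ p₂ ∈ ℝ^d denote the pointwise quotient with entries p₁(i)/p₂(i). Then ‖(p₁ ⊘ p₂)/‖p₁ ⊘ p₂‖₁ − (1/d, …, 1/d)‖₁ ≤ 2‖p₁ − p₂‖₁ / (d · minᵢ p₂(i)). -/
/-- Normalizing a positive vector moves it from the uniform distribution by at most twice its
mean absolute deviation from the all-ones vector. -/
theorem sum_abs_div_sum_sub_inv_card_le {d : ℕ} (hd : 0 < d) (r : Fin d → ℝ)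
    (hr : ∀ i, 0 < r i) :
    ∑ i, |r i / (∑ j, r j) - 1 / (d : ℝ)| ≤ 2 * (∑ i, |r i - 1|) / d := by
  have : Nonempty (Fin d) := ⟨⟨0, hd⟩⟩
  have hd' : (0 : ℝ) < d := by exact_mod_cast hd
  set S := ∑ j, r j with hS
  have hS_pos : 0 < S := Finset.sum_pos (fun i _ => hr i) Finset.univ_nonempty
  have h_total : |d - S| ≤ ∑ i, |r i - 1| := by
    have h : S - d = ∑ i, (r i - 1) := by simp [hS]
    rw [abs_sub_comm, h]
    exact Finset.abs_sum_le_sum_abs _ _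
  have h_term (i : Fin d) :
      |r i / S - 1 / (d : ℝ)| ≤ r i * (|d - S| / (S * d)) + |r i - 1| / d := by
    have h : r i / S - 1 / (d : ℝ) = r i * ((d - S) / (S * d)) + (r i - 1) / d := by
      field_simp
      ring
    rw [h]
    refine (abs_add_le _ _).trans_eq ?_
    rw [abs_mul, abs_div, abs_div, abs_of_pos (hr i), abs_of_pos (mul_pos hS_pos hd'),
      abs_of_pos hd']
  calc ∑ i, |r i / S - 1 / (d : ℝ)|
      ≤ ∑ i, (r i * (|d - S| / (S * d)) + |r i - 1| / d) :=
        Finset.sum_le_sum fun i _ => h_term i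
    _ = (|d - S| + ∑ i, |r i - 1|) / d := by
        rw [Finset.sum_add_distrib, ← Finset.sum_mul, ← Finset.sum_div, ← hS]
        field_simp
    _ ≤ 2 * (∑ i, |r i - 1|) / d := by
        gcongr
        linarith

/-- Perturbation of the normalized pointwise quotient around the
uniform distribution. -/
theorem division_prob_perturbation
    {d : ℕ} (hd : 0 < d) (p₁ p₂ : Fin d → ℝ)
    (hp₁_pos : ∀ i, 0 < p₁ i) (hp₂_pos : ∀ i, 0 < p₂ i) :
    ∑ i, |(p₁ i / p₂ i) / (∑ j, |p₁ j / p₂ j|) - 1 / (d : ℝ)|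
      ≤ 2 * (∑ i, |p₁ i - p₂ i|) / ((d : ℝ) * ⨅ i, p₂ i) := by
  have : Nonempty (Fin d) := ⟨⟨0, hd⟩⟩
  have hr (i : Fin d) : 0 < p₁ i / p₂ i := div_pos (hp₁_pos i) (hp₂_pos i)
  have hm_le (i : Fin d) : ⨅ j, p₂ j ≤ p₂ i := ciInf_le (Set.finite_range p₂).bddBelow i
  have hm_pos : 0 < ⨅ i, p₂ i := by
    obtain ⟨i, hi⟩ := exists_eq_ciInf_of_finite (f := p₂)
    exact hi ▸ hp₂_pos i
  have h_dev (i : Fin d) : |p₁ i / p₂ i - 1| ≤ |p₁ i - p₂ i| / ⨅ j, p₂ j := by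
    rw [div_sub_one (hp₂_pos i).ne', abs_div, abs_of_pos (hp₂_pos i)]
    exact div_le_div_of_nonneg_left (abs_nonneg _) hm_pos (hm_le i)
  simp only [fun j => abs_of_pos (hr j)]
  calc _ ≤ 2 * (∑ i, |p₁ i / p₂ i - 1|) / d := sum_abs_div_sum_sub_inv_card_le hd _ hr
    _ ≤ 2 * (∑ i, |p₁ i - p₂ i| / ⨅ j, p₂ j) / d := by
        gcongr with i
        exact h_dev i
    _ = 2 * (∑ i, |p₁ i - p₂ i|) / ((d : ℝ) * ⨅ i, p₂ i) := by
        rw [← Finset.sum_div, ← mul_div_assoc, div_div, mul_comm (d : ℝ)]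
end

section
/- Let d be a positive integer, let p₁, p₂ ∈ ℝ^d have nonnegative entries with ‖p₁‖₁ = ‖p₂‖₁ = 1, and suppose p₂ = (1/d, …, 1/d) is the uniform probability vector. Then for every q ∈ ℝ^d with nonnegative entries satisfying qᵀp₁ > 0 and qᵀp₂ > 0, one has ‖(q ⊙ p₁)/(qᵀp₁) − (q ⊙ p₂)/(qᵀp₂)‖₁ ≤ 2d‖p₁ − p₂‖₁. -/
/-- Normalizing two weight vectors at most doubles their `ℓ₁` distance relative to the second
total mass. -/
lemma sum_abs_div_sum_sub_div_sum_le {ι : Type*} (s : Finset ι) (a b : ι → ℝ)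
    (ha : ∀ i ∈ s, 0 ≤ a i) (hA : 0 < ∑ i ∈ s, a i) (hB : 0 < ∑ i ∈ s, b i) :
    ∑ i ∈ s, |a i / (∑ j ∈ s, a j) - b i / (∑ j ∈ s, b j)|
      ≤ 2 * (∑ i ∈ s, |a i - b i|) / ∑ i ∈ s, b i := by
  have hAB : |∑ i ∈ s, b i - ∑ i ∈ s, a i| ≤ ∑ i ∈ s, |a i - b i| := by
    rw [abs_sub_comm, ← Finset.sum_sub_distrib]
    exact Finset.abs_sum_le_sum_abs _ _
  have hsum : ∑ i ∈ s, a i / (∑ j ∈ s, a j) = 1 := by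
    rw [← Finset.sum_div, div_self hA.ne']
  set A := ∑ i ∈ s, a i
  set B := ∑ i ∈ s, b i
  calc ∑ i ∈ s, |a i / A - b i / B|
      ≤ ∑ i ∈ s, (|a i - b i| / B + a i / A * (|B - A| / B)) := by
        refine Finset.sum_le_sum fun i hi => ?_
        have hsplit : a i / A - b i / B = (a i - b i) / B + a i / A * ((B - A) / B) := by
          field_simp
          ring
        rw [hsplit]
        refine (abs_add_le _ _).trans_eq ?_
        rw [abs_mul, abs_div, abs_div (B - A), abs_of_pos hB,
          abs_of_nonneg (div_nonneg (ha i hi) hA.le)]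
    _ = (∑ i ∈ s, |a i - b i| + |B - A|) / B := by
        rw [Finset.sum_add_distrib, ← Finset.sum_div, ← Finset.sum_mul, hsum, one_mul, add_div]
    _ ≤ 2 * (∑ i ∈ s, |a i - b i|) / B := by
        gcongr
        linarith

/-- Conditional probability perturbation around the uniform
distribution. -/
theorem conditional_prob_perturbation
    {d : ℕ} (hd : 0 < d) (p₁ p₂ : Fin d → ℝ)
    (hp₁_nonneg : ∀ i, 0 ≤ p₁ i) (hp₂_nonneg : ∀ i, 0 ≤ p₂ i)
    (hp₁_norm : ∑ i, |p₁ i| = 1) (hp₂_norm : ∑ i, |p₂ i| = 1)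
    (hp₂_unif : ∀ i, p₂ i = 1 / (d : ℝ))
    (q : Fin d → ℝ) (hq_nonneg : ∀ i, 0 ≤ q i)
    (hq₁ : 0 < ∑ i, q i * p₁ i) (hq₂ : 0 < ∑ i, q i * p₂ i) :
    ∑ i, |q i * p₁ i / (∑ j, q j * p₁ j) - q i * p₂ i / (∑ j, q j * p₂ j)|
      ≤ 2 * (d : ℝ) * ∑ i, |p₁ i - p₂ i| := by
  refine (sum_abs_div_sum_sub_div_sum_le Finset.univ (fun i => q i * p₁ i) (fun i => q i * p₂ i)
    (fun i _ => mul_nonneg (hq_nonneg i) (hp₁_nonneg i)) hq₁ hq₂).trans ?_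
  have hd' : (0 : ℝ) < d := by exact_mod_cast hd
  have hq_le : ∀ i, q i ≤ d * ∑ j, q j * p₂ j := fun i => by
    have h := Finset.single_le_sum (f := fun j => q j * p₂ j)
      (fun j _ => mul_nonneg (hq_nonneg j) (hp₂_nonneg j)) (Finset.mem_univ i)
    calc q i = d * (q i * p₂ i) := by
          rw [hp₂_unif]
          field_simp
      _ ≤ d * ∑ j, q j * p₂ j := by gcongr
  rw [div_le_iff₀ hq₂]
  calc 2 * ∑ i, |q i * p₁ i - q i * p₂ i|
      ≤ 2 * ∑ i, (d * ∑ j, q j * p₂ j) * |p₁ i - p₂ i| := by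
        gcongr with i
        rw [← mul_sub, abs_mul, abs_of_nonneg (hq_nonneg i)]
        gcongr
        exact hq_le i
    _ = 2 * (d : ℝ) * (∑ i, |p₁ i - p₂ i|) * ∑ j, q j * p₂ j := by
        rw [← Finset.mul_sum]
        ring
end

section
/- Let Ω be a finite nonempty type equipped with a probability mass function P, let 𝒳 be a type, let X : Ω → 𝒳, and let Y : Ω → ℝⁿ be a map each of whose values is a standard basis vector of ℝⁿ. Define g* : 𝒳 → ℝⁿ on the image of X by g*(x) = E[Y | X = x] (the conditional mean of Y given X = x, i.e., g*(x) = (Σ_{ω : X(ω)=x} P(ω)Y(ω)) / (Σ_{ω : X(ω)=x} P(ω)) whenever P(X = x) > 0, and arbitrary in Δₙ otherwise). Then for every function g : 𝒳 → Δₙ, E[(‖g(X) − Y‖₂² − ‖g*(X) − Y‖₂²)²] ≤ 16·(E[‖g(X) − Y‖₂²] − E[‖g*(X) − Y‖₂²]). -/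
/-- Two points of the probability simplex have squared Euclidean distance at most `2`. -/
theorem sum_sq_sub_le_two_of_simplex {ι : Type*} [Fintype ι] {a b : ι → ℝ}
    (ha : (∀ i, 0 ≤ a i) ∧ ∑ i, a i = 1) (hb : (∀ i, 0 ≤ b i) ∧ ∑ i, b i = 1) :
    ∑ i, (a i - b i) ^ 2 ≤ 2 := by
  have le_one {c : ι → ℝ} (hc : (∀ i, 0 ≤ c i) ∧ ∑ i, c i = 1) (i : ι) : c i ≤ 1 :=
    hc.2 ▸ Finset.single_le_sum (fun j _ => hc.1 j) (Finset.mem_univ i)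
  calc ∑ i, (a i - b i) ^ 2 ≤ ∑ i, (a i + b i) := by
        refine Finset.sum_le_sum fun i _ => ?_
        nlinarith [ha.1 i, hb.1 i, le_one ha i, le_one hb i, mul_nonneg (ha.1 i) (hb.1 i),
          mul_nonneg (ha.1 i) (sub_nonneg.2 (le_one ha i)),
          mul_nonneg (hb.1 i) (sub_nonneg.2 (le_one hb i))]
    _ = 2 := by rw [Finset.sum_add_distrib, ha.2, hb.2]; norm_num

/-- Pointwise bound on the squared excess loss in terms of the distance of the predictions. -/
theorem sq_excess_loss_le_of_simplex {ι : Type*} [Fintype ι] {a b y : ι → ℝ}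
    (ha : (∀ i, 0 ≤ a i) ∧ ∑ i, a i = 1) (hb : (∀ i, 0 ≤ b i) ∧ ∑ i, b i = 1)
    (hy : (∀ i, 0 ≤ y i) ∧ ∑ i, y i = 1) :
    ((∑ i, (a i - y i) ^ 2) - ∑ i, (b i - y i) ^ 2) ^ 2 ≤ 8 * ∑ i, (a i - b i) ^ 2 := by
  have hfactor : (∑ i, (a i - y i) ^ 2) - ∑ i, (b i - y i) ^ 2
      = ∑ i, (a i - b i) * (a i + b i - 2 * y i) := by
    rw [← Finset.sum_sub_distrib]
    exact Finset.sum_congr rfl fun i _ => by ring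
  have hbound : ∑ i, (a i + b i - 2 * y i) ^ 2 ≤ 8 := by
    calc ∑ i, (a i + b i - 2 * y i) ^ 2
        ≤ ∑ i, (2 * (a i - y i) ^ 2 + 2 * (b i - y i) ^ 2) :=
          Finset.sum_le_sum fun i _ => by nlinarith [sq_nonneg (a i - b i)]
      _ = 2 * ∑ i, (a i - y i) ^ 2 + 2 * ∑ i, (b i - y i) ^ 2 := by
          rw [Finset.sum_add_distrib, Finset.mul_sum, Finset.mul_sum]
      _ ≤ 8 := by
          linarith [sum_sq_sub_le_two_of_simplex ha hy, sum_sq_sub_le_two_of_simplex hb hy]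
  rw [hfactor]
  calc _ ≤ (∑ i, (a i - b i) ^ 2) * ∑ i, (a i + b i - 2 * y i) ^ 2 :=
        Finset.sum_mul_sq_le_sq_mul_sq _ _ _
    _ ≤ (∑ i, (a i - b i) ^ 2) * 8 :=
        mul_le_mul_of_nonneg_left hbound (Finset.sum_nonneg fun i _ => sq_nonneg _)
    _ = _ := mul_comm _ _

/-- The residual of the conditional mean is orthogonal to every function of `X`. -/
theorem sum_mul_condMean_sub_eq_zero {Ω 𝒳 : Type*} [Fintype Ω] [DecidableEq 𝒳]
    {P : Ω → ℝ} (hP : ∀ ω, 0 ≤ P ω) (X : Ω → 𝒳) (Z : Ω → ℝ) (m : 𝒳 → ℝ)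
    (hm : ∀ x, 0 < ∑ ω ∈ Finset.univ.filter (fun ω => X ω = x), P ω →
      m x = (∑ ω ∈ Finset.univ.filter (fun ω => X ω = x), P ω * Z ω) /
        ∑ ω ∈ Finset.univ.filter (fun ω => X ω = x), P ω)
    (h : 𝒳 → ℝ) :
    ∑ ω, P ω * (h (X ω) * (m (X ω) - Z ω)) = 0 := by
  rw [← Finset.sum_fiberwise_of_maps_to (t := Finset.univ.image X) (g := X)
    fun ω _ => Finset.mem_image_of_mem X (Finset.mem_univ ω)]
  refine Finset.sum_eq_zero fun x _ => ?_
  have hfiber : ∑ ω ∈ Finset.univ.filter (fun ω => X ω = x),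
        P ω * (h (X ω) * (m (X ω) - Z ω))
      = h x * (m x * (∑ ω ∈ Finset.univ.filter (fun ω => X ω = x), P ω)
        - ∑ ω ∈ Finset.univ.filter (fun ω => X ω = x), P ω * Z ω) := by
    rw [Finset.mul_sum, ← Finset.sum_sub_distrib, Finset.mul_sum]
    refine Finset.sum_congr rfl fun ω hω => ?_
    rw [(Finset.mem_filter.1 hω).2]
    ring
  rw [hfiber]
  rcases (Finset.sum_nonneg fun ω _ => hP ω :
    0 ≤ ∑ ω ∈ Finset.univ.filter (fun ω => X ω = x), P ω).eq_or_lt with h0 | hpos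
  · have hzero := (Finset.sum_eq_zero_iff_of_nonneg fun ω _ => hP ω).1 h0.symm
    rw [← h0, Finset.sum_eq_zero fun ω hω => by rw [hzero ω hω, zero_mul]]
    ring
  · rw [hm x hpos, div_mul_cancel₀ _ hpos.ne', sub_self, mul_zero]

/-- Second-moment bound on the excess squared loss relative to the
conditional-mean (least-squares optimal) predictor, when the target Y takes
standard-basis-vector values. -/
theorem excess_risk_second_moment_bound
    {Ω 𝒳 : Type*} [Fintype Ω] [Nonempty Ω] [DecidableEq 𝒳] {n : ℕ}
    (P : Ω → ℝ) (hP_nonneg : ∀ ω, 0 ≤ P ω) (hP_sum : ∑ ω, P ω = 1)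
    (X : Ω → 𝒳) (Y : Ω → Fin n → ℝ)
    (hY : ∀ ω, ∃ i, Y ω = Pi.single i 1)
    (gstar : 𝒳 → Fin n → ℝ)
    (hgstar_simplex : ∀ x, (∀ i, 0 ≤ gstar x i) ∧ ∑ i, gstar x i = 1)
    (hgstar_mean : ∀ x,
      0 < ∑ ω ∈ Finset.univ.filter (fun ω => X ω = x), P ω →
      ∀ i, gstar x i =
        (∑ ω ∈ Finset.univ.filter (fun ω => X ω = x), P ω * Y ω i) /
          ∑ ω ∈ Finset.univ.filter (fun ω => X ω = x), P ω)
    (g : 𝒳 → Fin n → ℝ)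
    (hg_simplex : ∀ x, (∀ i, 0 ≤ g x i) ∧ ∑ i, g x i = 1) :
    ∑ ω, P ω * ((∑ i, (g (X ω) i - Y ω i) ^ 2) - ∑ i, (gstar (X ω) i - Y ω i) ^ 2) ^ 2
      ≤ 16 * ((∑ ω, P ω * ∑ i, (g (X ω) i - Y ω i) ^ 2)
              - ∑ ω, P ω * ∑ i, (gstar (X ω) i - Y ω i) ^ 2) := by
  have hY_simplex (ω : Ω) : (∀ i, 0 ≤ Y ω i) ∧ ∑ i, Y ω i = 1 := by
    obtain ⟨j, hj⟩ := hY ω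
    rw [hj]
    exact ⟨fun i => (Pi.single_nonneg.2 zero_le_one : (0 : Fin n → ℝ) ≤ Pi.single j 1) i,
      by simp⟩
  have hcross : ∑ ω, P ω * ∑ i, (g (X ω) i - gstar (X ω) i) * (gstar (X ω) i - Y ω i) = 0 := by
    simp_rw [Finset.mul_sum]
    rw [Finset.sum_comm]
    exact Finset.sum_eq_zero fun i _ =>
      sum_mul_condMean_sub_eq_zero hP_nonneg X (fun ω => Y ω i) (fun x => gstar x i)
        (fun x hx => hgstar_mean x hx i) fun x => g x i - gstar x i
  have hexcess : (∑ ω, P ω * ∑ i, (g (X ω) i - Y ω i) ^ 2)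
      - ∑ ω, P ω * ∑ i, (gstar (X ω) i - Y ω i) ^ 2
      = ∑ ω, P ω * ∑ i, (g (X ω) i - gstar (X ω) i) ^ 2 := by
    rw [← add_zero (∑ ω, P ω * ∑ i, (g (X ω) i - gstar (X ω) i) ^ 2), ← mul_zero 2, ← hcross,
      ← Finset.sum_sub_distrib, Finset.mul_sum, ← Finset.sum_add_distrib]
    refine Finset.sum_congr rfl fun ω _ => ?_
    rw [mul_left_comm, ← mul_sub, ← mul_add, ← Finset.sum_sub_distrib]
    congr 1
    rw [Finset.mul_sum, ← Finset.sum_add_distrib]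
    exact Finset.sum_congr rfl fun i _ => by ring
  rw [hexcess, Finset.mul_sum]
  refine Finset.sum_le_sum fun ω _ => ?_
  have hdist : 0 ≤ ∑ i, (g (X ω) i - gstar (X ω) i) ^ 2 :=
    Finset.sum_nonneg fun i _ => sq_nonneg _
  rw [mul_left_comm]
  refine mul_le_mul_of_nonneg_left ?_ (hP_nonneg ω)
  linarith [sq_excess_loss_le_of_simplex (hg_simplex (X ω)) (hgstar_simplex (X ω))
    (hY_simplex ω)]
end

section
/- Let S, A, S' be finite nonempty sets, let p be a transition kernel from S×A to S', and let ν be a probability distribution on S×A such that Z_ν(s') > 0 for every s' ∈ S'. Let X be a measurable space partitioned into disjoint measurable blocks {X_{s'}}_{s' ∈ S'}, and for each s' ∈ S' let q(·|s') be a probability measure on X with q(X_{s'}|s') = 1. Let ν̃ be the joint distribution of (s, a, x') obtained by sampling (s,a) ∼ ν, then s' ∼ p(·|s,a), then x' ∼ q(·|s'). Let G be a set of measurable functions from X to the simplex Δ of probability vectors on S×A, and assume realizability: for every function φ : S' → Δ there exists g ∈ G such that for every s' ∈ S', g(x') = φ(s') for q(·|s')-almost every x'. Then every g_h ∈ G that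 minimizes over G the risk E_{ν̃}[‖g(x') − e_{(s,a)}‖₂²] satisfies, for every s' ∈ S', g_h(x') = b_ν(s') for q(·|s')-almost every x' ∈ X_{s'}. -/
open MeasureTheory

/-- Bias-variance decomposition of the weighted squared distance to the vertices of the simplex. -/
lemma sum_mul_sq_dist_single {ι : Type*} [Fintype ι] [DecidableEq ι] (w y : ι → ℝ)
    (hZ : 0 < ∑ i, w i) :
    ∑ i, w i * ∑ j, (y j - (Pi.single i (1 : ℝ) : ι → ℝ) j) ^ 2 =
      (∑ i, w i) * ∑ j, (y j - w j / ∑ i, w i) ^ 2 + ∑ j, (w j - w j ^ 2 / ∑ i, w i) := by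
  simp_rw [Finset.mul_sum]
  rw [Finset.sum_comm, ← Finset.sum_add_distrib]
  refine Finset.sum_congr rfl fun j _ => ?_
  have hterm : ∀ i, w i * (y j - (Pi.single i (1 : ℝ) : ι → ℝ) j) ^ 2 =
      w i * y j ^ 2 + if j = i then w i * (1 - 2 * y j) else 0 := by
    intro i
    rw [Pi.single_apply]
    split_ifs <;> ring
  simp_rw [hterm]
  rw [Finset.sum_add_distrib, ← Finset.sum_mul, Finset.sum_ite_eq, if_pos (Finset.mem_univ j)]
  field_simp
  ring

/-- The squared distance of a measurable simplex-valued function to a fixed vector is integrable. -/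
lemma integrable_sum_sq_sub {ι X : Type*} [Fintype ι] [MeasurableSpace X] (μ : Measure X)
    [IsFiniteMeasure μ] (g : X → ι → ℝ) (hg : ∀ i, Measurable fun x => g x i)
    (hs : ∀ x, (∀ i, 0 ≤ g x i) ∧ ∑ i, g x i = 1) (c : ι → ℝ) :
    Integrable (fun x => ∑ i, (g x i - c i) ^ 2) μ := by
  refine integrable_finsetSum _ fun i _ => ?_
  refine Integrable.of_bound (((hg i).sub_const (c i)).pow_const 2).aestronglyMeasurable
    ((1 + |c i|) ^ 2) (Filter.Eventually.of_forall fun x => ?_)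
  have h0 := (hs x).1 i
  have h1 : g x i ≤ 1 := by
    rw [← (hs x).2]
    exact Finset.single_le_sum (fun j _ => (hs x).1 j) (Finset.mem_univ i)
  rw [norm_pow, Real.norm_eq_abs]
  gcongr
  exact (abs_sub _ _).trans (by rw [abs_of_nonneg h0]; gcongr)

/-- The risk is the weighted mean squared distance to the normalized weights, up to a term that
does not depend on the function. -/
lemma risk_eq {ι κ X : Type*} [Fintype ι] [DecidableEq ι] [Fintype κ] [MeasurableSpace X]
    (p : ι → κ → ℝ) (ν : ι → ℝ) (hZ : ∀ k, 0 < ∑ i, p i k * ν i)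
    (q : κ → Measure X) (hq : ∀ k, IsProbabilityMeasure (q k))
    (g : X → ι → ℝ) (hg : ∀ i, Measurable fun x => g x i)
    (hs : ∀ x, (∀ i, 0 ≤ g x i) ∧ ∑ i, g x i = 1) :
    (∑ i, ν i * ∑ k, p i k *
        ∫ x, (∑ j, (g x j - (Pi.single i (1 : ℝ) : ι → ℝ) j) ^ 2) ∂ q k) =
      ∑ k, (∑ i, p i k * ν i) *
          ∫ x, (∑ j, (g x j - p j k * ν j / ∑ i, p i k * ν i) ^ 2) ∂ q k +
        ∑ k, ∑ j, (p j k * ν j - (p j k * ν j) ^ 2 / ∑ i, p i k * ν i) := by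
  simp_rw [Finset.mul_sum (s := (Finset.univ : Finset κ))]
  rw [Finset.sum_comm, ← Finset.sum_add_distrib]
  refine Finset.sum_congr rfl fun k _ => ?_
  have := hq k
  have hint := integrable_sum_sq_sub (q k) g hg hs
  calc _ = ∑ i, ∫ x, (p i k * ν i) *
          ∑ j, (g x j - (Pi.single i (1 : ℝ) : ι → ℝ) j) ^ 2 ∂ q k := by
        refine Finset.sum_congr rfl fun i _ => ?_
        rw [integral_const_mul]
        ring
    _ = ∫ x, ∑ i, (p i k * ν i) *
          ∑ j, (g x j - (Pi.single i (1 : ℝ) : ι → ℝ) j) ^ 2 ∂ q k :=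
        (integral_finsetSum _ fun i _ => (hint _).const_mul _).symm
    _ = ∫ x, ((∑ i, p i k * ν i) * ∑ j, (g x j - p j k * ν j / ∑ i, p i k * ν i) ^ 2 +
          ∑ j, (p j k * ν j - (p j k * ν j) ^ 2 / ∑ i, p i k * ν i)) ∂ q k :=
        integral_congr_ae (Filter.Eventually.of_forall fun x =>
          sum_mul_sq_dist_single (fun i => p i k * ν i) (g x) (hZ k))
    _ = _ := by
        rw [integral_add ((hint _).const_mul _) (integrable_const _), integral_const_mul]
        simp

/-- In a block MDP, any risk minimizer over a realizable class of
simplex-valued context-embedding functions coincides (almost everywhere on each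
block) with the backward probability vector of the emitting latent state. -/
theorem risk_minimizer_is_backward_prob
    {S A S' : Type*} [Fintype S] [Fintype A] [Fintype S']
    [Nonempty S] [Nonempty A] [Nonempty S']
    [DecidableEq S] [DecidableEq A]
    {X : Type*} [MeasurableSpace X]
    (p : S × A → S' → ℝ)
    (hp_nonneg : ∀ sa s', 0 ≤ p sa s')
    (hp_sum : ∀ sa, ∑ s', p sa s' = 1)
    (ν : S × A → ℝ)
    (hν_nonneg : ∀ sa, 0 ≤ ν sa)
    (hν_sum : ∑ sa, ν sa = 1)
    (hZ : ∀ s', 0 < ∑ sa, p sa s' * ν sa)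
    (Xs : S' → Set X)
    (hXs_meas : ∀ s', MeasurableSet (Xs s'))
    (hXs_disj : Pairwise (Function.onFun Disjoint Xs))
    (hXs_cover : (⋃ s', Xs s') = Set.univ)
    (q : S' → Measure X)
    (hq_prob : ∀ s', IsProbabilityMeasure (q s'))
    (hq_supp : ∀ s', q s' (Xs s') = 1)
    (G : Set (X → S × A → ℝ))
    (hG_meas : ∀ g ∈ G, ∀ sa, Measurable fun x => g x sa)
    (hG_simplex : ∀ g ∈ G, ∀ x, (∀ sa, 0 ≤ g x sa) ∧ ∑ sa, g x sa = 1)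
    (hreal : ∀ φ : S' → S × A → ℝ,
      (∀ s', (∀ sa, 0 ≤ φ s' sa) ∧ ∑ sa, φ s' sa = 1) →
      ∃ g ∈ G, ∀ s', ∀ᵐ x' ∂ q s', g x' = φ s')
    (gh : X → S × A → ℝ) (hgh_mem : gh ∈ G)
    (hgh_min : ∀ g ∈ G,
      (∑ sa, ν sa * ∑ s', p sa s' *
        ∫ x', (∑ sa', (gh x' sa' - (Pi.single sa (1 : ℝ) : S × A → ℝ) sa') ^ 2) ∂ q s')
      ≤ ∑ sa, ν sa * ∑ s', p sa s' *
        ∫ x', (∑ sa', (g x' sa' - (Pi.single sa (1 : ℝ) : S × A → ℝ) sa') ^ 2) ∂ q s') :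
    ∀ s', ∀ᵐ x' ∂ q s', x' ∈ Xs s' →
      gh x' = fun sa => p sa s' * ν sa / ∑ sa'', p sa'' s' * ν sa'' := by
  obtain ⟨g, hgG, hg⟩ := hreal (fun s' sa => p sa s' * ν sa / ∑ sa'', p sa'' s' * ν sa'')
    fun s' => ⟨fun sa => div_nonneg (mul_nonneg (hp_nonneg _ _) (hν_nonneg _)) (hZ s').le, by
      rw [← Finset.sum_div, div_self (hZ s').ne']⟩
  have hle := hgh_min g hgG
  rw [risk_eq p ν hZ q hq_prob gh (hG_meas gh hgh_mem) (hG_simplex gh hgh_mem),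
    risk_eq p ν hZ q hq_prob g (hG_meas g hgG) (hG_simplex g hgG)] at hle
  have hg_zero : ∀ s', ∫ x, (∑ j, (g x j - p j s' * ν j / ∑ i, p i s' * ν i) ^ 2) ∂ q s' = 0 :=
    fun s' => integral_eq_zero_of_ae ((hg s').mono fun x hx => by simp [hx])
  simp_rw [hg_zero, mul_zero, Finset.sum_const_zero] at hle
  have hnonneg : ∀ s' x, 0 ≤ ∑ j, (gh x j - p j s' * ν j / ∑ i, p i s' * ν i) ^ 2 :=
    fun s' x => Finset.sum_nonneg fun j _ => sq_nonneg _
  have hterm : ∀ s' ∈ Finset.univ, 0 ≤ (∑ i, p i s' * ν i) *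
      ∫ x, (∑ j, (gh x j - p j s' * ν j / ∑ i, p i s' * ν i) ^ 2) ∂ q s' :=
    fun s' _ => mul_nonneg (hZ s').le (integral_nonneg (hnonneg s'))
  intro s'
  have := hq_prob s'
  have hzero := (Finset.sum_eq_zero_iff_of_nonneg hterm).1
    (le_antisymm (by linarith) (Finset.sum_nonneg hterm)) s' (Finset.mem_univ s')
  have hae := (integral_eq_zero_iff_of_nonneg (hnonneg s')
    (integrable_sum_sq_sub (q s') gh (hG_meas gh hgh_mem) (hG_simplex gh hgh_mem) _)).1
    ((mul_eq_zero.1 hzero).resolve_left (hZ s').ne')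
  filter_upwards [hae] with x hx _
  funext sa
  have hsa := (Finset.sum_eq_zero_iff_of_nonneg fun j _ => sq_nonneg _).1 hx sa
    (Finset.mem_univ sa)
  exact sub_eq_zero.1 (pow_eq_zero_iff two_ne_zero |>.1 hsa)
end
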